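/- arXiv:1406.5686 — 2 statements merged into one kernel-verified Lean document; each statement's English description precedes it below -/
import Mathlib

section
/- Let A be a positive definite n×n complex matrix and H an arbitrary n×n complex matrix. Then the Fréchet derivative of the matrix logarithm at A applied to H equals the integral ∫₀^∞ (A + t·1)^{-1} H (A + t·1)^{-1} dt. -/
open Matrix MeasureTheory
open scoped ComplexOrder

attribute [local instance] Matrix.frobeniusNormedAddCommGroup Matrix.frobeniusNormedSpace

/-- The matrix logarithm of a positive definite complex matrix, defined via the continuous
functional calculus (for Hermitian matrices) applied to the real logarithm. -/
noncomputable def matLog {n : ℕ} (A : Matrix (Fin n) (Fin n) ℂ) : Matrix (Fin n) (Fin n) ℂ :=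
  cfc Real.log A

/-- The spectral resolution of a positive definite matrix, simultaneously expressing its logarithm
and its resolvent. -/
theorem Matrix.PosDef.exists_spectral_resolution {n : ℕ} {A : Matrix (Fin n) (Fin n) ℂ}
    (hA : A.PosDef) :
    ∃ (l : Fin n → ℝ) (P : Fin n → Matrix (Fin n) (Fin n) ℂ), (∀ i, 0 < l i) ∧ ∑ i, P i = 1 ∧
      matLog A = ∑ i, Real.log (l i) • P i ∧
      ∀ t : ℝ, 0 ≤ t → (A + t • 1)⁻¹ = ∑ i, (l i + t)⁻¹ • P i := by
  have hH := hA.isHermitian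
  set Φ := Unitary.conjStarAlgAut ℂ _ hH.eigenvectorUnitary with hΦ
  set l := hH.eigenvalues with hl
  have key (f : Fin n → ℝ) : Φ (diagonal fun i ↦ (f i : ℂ)) =
      ∑ i, f i • Φ (Matrix.single i i 1) := by
    have h : (diagonal fun i ↦ (f i : ℂ)) =
        ∑ i, (f i : ℂ) • (Matrix.single i i 1 : Matrix (Fin n) (Fin n) ℂ) := by
      rw [← Matrix.sum_single_eq_diagonal]
      simp [Matrix.smul_single]
    rw [h, map_sum]
    refine Finset.sum_congr rfl fun i _ ↦ ?_
    rw [map_smul]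
    ext a b
    simp
  have hpos : ∀ i, 0 < l i := hA.eigenvalues_pos
  have hone : ∑ i, Φ (Matrix.single i i 1) = 1 := by
    have := key fun _ ↦ 1
    simpa using this.symm
  refine ⟨l, fun i ↦ Φ (Matrix.single i i 1), hpos, hone, ?_, fun t ht ↦ ?_⟩
  · rw [matLog, hH.cfc_eq, ← key]
    rfl
  · have hAt : A + t • 1 = Φ (diagonal fun i ↦ ((l i + t : ℝ) : ℂ)) := by
      conv_lhs => rw [hH.spectral_theorem]
      rw [key]
      simp only [add_smul, Finset.sum_add_distrib, ← Finset.smul_sum, hone]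
      rw [← key]
      rfl
    rw [← key, hAt]
    refine Matrix.inv_eq_left_inv ?_
    rw [← map_mul, diagonal_mul_diagonal, ← map_one Φ, ← diagonal_one]
    congr 2
    ext i
    have : (l i + t) ≠ 0 := by have := hpos i; positivity
    rw [← Complex.ofReal_mul, inv_mul_cancel₀ this, Complex.ofReal_one]

/-- Frullani-type representation of the logarithm. -/
theorem Real.integrableOn_and_integral_inv_sub_inv {a : ℝ} (ha : 0 < a) :
    IntegrableOn (fun t : ℝ ↦ (1 + t)⁻¹ - (a + t)⁻¹) (Set.Ioi 0) ∧
      ∫ t in Set.Ioi (0 : ℝ), ((1 + t)⁻¹ - (a + t)⁻¹) = Real.log a := by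
  have hd : ∀ x ∈ Set.Ici (0 : ℝ), HasDerivAt (fun t : ℝ ↦ Real.log (1 + t) - Real.log (a + t))
      ((1 + x)⁻¹ - (a + x)⁻¹) x := by
    intro x hx
    have hx : 0 ≤ x := hx
    convert! (((hasDerivAt_id x).const_add 1).log (by simp; positivity)).sub
      (((hasDerivAt_id x).const_add a).log (by simp; positivity)) using 1
    simp
  have hlim : Filter.Tendsto (fun t : ℝ ↦ Real.log (1 + t) - Real.log (a + t)) Filter.atTop
      (nhds 0) := by
    have h1 : Filter.Tendsto (fun t : ℝ ↦ 1 + (1 - a) * (a + t)⁻¹) Filter.atTop (nhds 1) := by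
      have : Filter.Tendsto (fun t : ℝ ↦ (a + t)⁻¹) Filter.atTop (nhds 0) :=
        tendsto_inv_atTop_zero.comp (Filter.tendsto_atTop_add_const_left _ a Filter.tendsto_id)
      simpa using (this.const_mul (1 - a)).const_add 1
    have h2 := h1.log one_ne_zero
    rw [Real.log_one] at h2
    refine h2.congr' ?_
    filter_upwards [Filter.eventually_ge_atTop 0] with t ht
    have : a + t ≠ 0 := by positivity
    rw [← Real.log_div (by positivity) this]
    congr 1
    field_simp
    ring
  have hint : IntegrableOn (fun t : ℝ ↦ (1 + t)⁻¹ - (a + t)⁻¹) (Set.Ioi 0) := by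
    rcases le_total 1 a with h | h
    · refine integrableOn_Ioi_deriv_of_nonneg' hd (fun x hx ↦ sub_nonneg.2 ?_) hlim
      have hx : 0 < x := hx
      gcongr
    · refine integrableOn_Ioi_deriv_of_nonpos' hd (fun x hx ↦ sub_nonpos.2 ?_) hlim
      have hx : 0 < x := hx
      gcongr
  refine ⟨hint, ?_⟩
  rw [integral_Ioi_of_hasDerivAt_of_tendsto' hd hint hlim]
  simp

section FrobeniusTopology

/-- The topology induced by the Frobenius norm, taking precedence over the (equal) entrywise one. -/
noncomputable local instance frobeniusTopologicalSpace {n : ℕ} :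
    TopologicalSpace (Matrix (Fin n) (Fin n) ℂ) :=
  Matrix.frobeniusNormedAddCommGroup.toPseudoMetricSpace.toUniformSpace.toTopologicalSpace

theorem Matrix.PosDef.matLog_eq_integral {n : ℕ} {A : Matrix (Fin n) (Fin n) ℂ} (hA : A.PosDef) :
    IntegrableOn (fun t : ℝ ↦ (1 + t)⁻¹ • (1 : Matrix (Fin n) (Fin n) ℂ) - (A + t • 1)⁻¹)
        (Set.Ioi 0) ∧
      matLog A = ∫ t in Set.Ioi (0 : ℝ), ((1 + t)⁻¹ • 1 - (A + t • 1)⁻¹) := by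
  obtain ⟨l, P, hl, hone, hlog, hinv⟩ := hA.exists_spectral_resolution
  have heq : Set.EqOn (fun t : ℝ ↦ ∑ i, ((1 + t)⁻¹ - (l i + t)⁻¹) • P i)
      (fun t : ℝ ↦ (1 + t)⁻¹ • 1 - (A + t • 1)⁻¹) (Set.Ioi 0) := by
    intro t ht
    simp only [hinv t (le_of_lt ht), sub_smul, Finset.sum_sub_distrib, ← Finset.smul_sum, hone]
  have hint (i : Fin n) : IntegrableOn (fun t : ℝ ↦ ((1 + t)⁻¹ - (l i + t)⁻¹) • P i)
      (Set.Ioi 0) :=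
    (Real.integrableOn_and_integral_inv_sub_inv (hl i)).1.smul_const _
  refine ⟨IntegrableOn.congr_fun (integrable_finsetSum _ fun i _ ↦ hint i) heq measurableSet_Ioi,
    ?_⟩
  rw [← setIntegral_congr_fun measurableSet_Ioi heq, integral_finsetSum _ fun i _ ↦ hint i, hlog]
  refine Finset.sum_congr rfl fun i _ ↦ ?_
  rw [integral_smul_const, (Real.integrableOn_and_integral_inv_sub_inv (hl i)).2]

theorem Matrix.PosDef.exists_norm_resolvent_le {n : ℕ} {A : Matrix (Fin n) (Fin n) ℂ}
    (hA : A.PosDef) :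
    ∃ c K : ℝ, 0 < c ∧ 0 < K ∧ ∀ t : ℝ, 0 ≤ t → ‖(A + t • 1)⁻¹‖ ≤ K * (c + t)⁻¹ := by
  obtain ⟨l, P, hl, -, -, hinv⟩ := hA.exists_spectral_resolution
  obtain ⟨c, hc, hcl⟩ : ∃ c : ℝ, 0 < c ∧ ∀ i, c ≤ l i := by
    obtain ⟨c, hc⟩ := Finite.exists_ge fun i ↦ (⟨l i, hl i⟩ : Set.Ioi (0 : ℝ))
    exact ⟨c, c.2, hc⟩
  refine ⟨c, ∑ i, ‖P i‖ + 1, hc, by positivity, fun t ht ↦ ?_⟩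
  rw [hinv t ht]
  calc ‖∑ i, (l i + t)⁻¹ • P i‖ ≤ ∑ i, ‖P i‖ * (c + t)⁻¹ := by
        refine norm_sum_le_of_le _ fun i _ ↦ ?_
        have := hcl i
        have := hl i
        rw [norm_smul, Real.norm_of_nonneg (by positivity), mul_comm]
        gcongr
    _ ≤ (∑ i, ‖P i‖ + 1) * (c + t)⁻¹ := by
        rw [← Finset.sum_mul]
        gcongr
        linarith

theorem Matrix.PosDef.continuousOn_resolvent {n : ℕ} {A : Matrix (Fin n) (Fin n) ℂ}
    (hA : A.PosDef) : ContinuousOn (fun t : ℝ ↦ (A + t • 1)⁻¹) (Set.Ioi 0) := by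
  obtain ⟨l, P, hl, -, -, hinv⟩ := hA.exists_spectral_resolution
  refine ContinuousOn.congr (f := fun t : ℝ ↦ ∑ i, (l i + t)⁻¹ • P i) ?_
    fun t ht ↦ hinv t (le_of_lt ht)
  refine continuousOn_finsetSum _ fun i _ ↦ ContinuousOn.smul (ContinuousOn.inv₀ (continuousOn_const.add continuousOn_id) ?_)
    continuousOn_const
  exact fun t ht ↦ (add_pos (hl i) ht).ne'

theorem integrableOn_inv_add_sq {c : ℝ} (hc : 0 < c) :
    IntegrableOn (fun t : ℝ ↦ ((c + t)⁻¹) ^ 2) (Set.Ioi 0) := by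
  refine (integrableOn_add_rpow_Ioi_of_lt (a := -2) (c := 0) (m := c) (by norm_num)
    (by linarith)).congr_fun (fun t ht ↦ ?_) measurableSet_Ioi
  have ht : 0 < t := ht
  simp only
  rw [Real.rpow_neg (by positivity), inv_pow, add_comm]
  norm_cast

theorem Matrix.PosDef.integrableOn_resolvent_mul_resolvent {n : ℕ}
    {A : Matrix (Fin n) (Fin n) ℂ} (hA : A.PosDef) (H : Matrix (Fin n) (Fin n) ℂ) :
    IntegrableOn (fun t : ℝ ↦ (A + t • 1)⁻¹ * H * (A + t • 1)⁻¹) (Set.Ioi 0) := by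
  obtain ⟨c, K, hc, hK, hb⟩ := hA.exists_norm_resolvent_le
  have hcont := hA.continuousOn_resolvent
  have : ContinuousMul (Matrix (Fin n) (Fin n) ℂ) :=
    letI := Matrix.frobeniusNormedRing (m := Fin n) (α := ℂ)
    inferInstance
  refine Integrable.mono' ((integrableOn_inv_add_sq hc).const_mul (K ^ 2 * ‖H‖))
    (((hcont.mul continuousOn_const).mul hcont).aestronglyMeasurable measurableSet_Ioi) ?_
  refine (ae_restrict_iff' measurableSet_Ioi).2 (Filter.Eventually.of_forall fun t ht ↦ ?_)
  have ht : 0 < t := ht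
  have h := hb t ht.le
  calc _ ≤ ‖(A + t • 1)⁻¹‖ * ‖H‖ * ‖(A + t • 1)⁻¹‖ :=
        (frobenius_norm_mul _ _).trans
          (mul_le_mul_of_nonneg_right (frobenius_norm_mul _ _) (norm_nonneg _))
    _ ≤ (K * (c + t)⁻¹) * ‖H‖ * (K * (c + t)⁻¹) := by gcongr
    _ = _ := by ring

theorem Matrix.PosDef.isUnit_det_add_smul_one {n : ℕ} {A : Matrix (Fin n) (Fin n) ℂ}
    (hA : A.PosDef) {t : ℝ} (ht : 0 ≤ t) : IsUnit (A + t • 1).det := by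
  have h : (t • (1 : Matrix (Fin n) (Fin n) ℂ)).PosSemidef := PosSemidef.one.smul ht
  exact (Matrix.isUnit_iff_isUnit_det _).1 (hA.add_posSemidef h).isUnit

/-- The derivative of the matrix logarithm, as a continuous linear map. -/
noncomputable def Matrix.PosDef.matLogDeriv {n : ℕ} {A : Matrix (Fin n) (Fin n) ℂ}
    (hA : A.PosDef) : Matrix (Fin n) (Fin n) ℂ →L[ℝ] Matrix (Fin n) (Fin n) ℂ :=
  LinearMap.toContinuousLinearMap
    { toFun := fun H ↦ ∫ t in Set.Ioi (0 : ℝ), (A + t • 1)⁻¹ * H * (A + t • 1)⁻¹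
      map_add' := fun H₁ H₂ ↦ by
        rw [← integral_add (hA.integrableOn_resolvent_mul_resolvent H₁)
          (hA.integrableOn_resolvent_mul_resolvent H₂)]
        simp only [mul_add, add_mul]
      map_smul' := fun r H ↦ by
        simp only [Matrix.mul_smul, Matrix.smul_mul, integral_smul, RingHom.id_apply] }

/-- The second resolvent identity. -/
theorem Matrix.PosDef.resolvent_sub_resolvent {n : ℕ} {A B : Matrix (Fin n) (Fin n) ℂ}
    (hA : A.PosDef) (hB : B.PosDef) {t : ℝ} (ht : 0 ≤ t) :
    (A + t • 1)⁻¹ - (B + t • 1)⁻¹ = (A + t • 1)⁻¹ * (B - A) * (B + t • 1)⁻¹ := by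
  rw [show B - A = (B + t • 1) - (A + t • 1) by abel, mul_sub, sub_mul,
    Matrix.nonsing_inv_mul _ (hA.isUnit_det_add_smul_one ht), mul_assoc,
    Matrix.mul_nonsing_inv _ (hB.isUnit_det_add_smul_one ht), mul_one, one_mul]

/-- The logarithm is approximated to second order by its linearization. -/
theorem Matrix.PosDef.exists_norm_matLog_sub_sub_le {n : ℕ} {A : Matrix (Fin n) (Fin n) ℂ}
    (hA : A.PosDef) :
    ∃ C δ : ℝ, 0 < δ ∧ ∀ B : Matrix (Fin n) (Fin n) ℂ, B.PosDef → ‖B - A‖ ≤ δ →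
      ‖matLog B - matLog A - hA.matLogDeriv (B - A)‖ ≤ C * ‖B - A‖ ^ 2 := by
  obtain ⟨c, K, hc, hK, hb⟩ := hA.exists_norm_resolvent_le
  refine ⟨2 * K ^ 3 * c⁻¹ * ∫ t in Set.Ioi (0 : ℝ), ((c + t)⁻¹) ^ 2, c / (2 * K), by positivity,
    fun B hB hBA ↦ ?_⟩
  have hAi := hA.matLog_eq_integral
  have hBi := hB.matLog_eq_integral
  have hLi := hA.integrableOn_resolvent_mul_resolvent (B - A)
  have hrep : matLog B - matLog A - hA.matLogDeriv (B - A) =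
      ∫ t in Set.Ioi (0 : ℝ), (((1 + t)⁻¹ • 1 - (B + t • 1)⁻¹) - ((1 + t)⁻¹ • 1 - (A + t • 1)⁻¹) -
        (A + t • 1)⁻¹ * (B - A) * (A + t • 1)⁻¹) := by
    rw [hAi.2, hBi.2, ← integral_sub hBi.1 hAi.1]
    exact (integral_sub (hBi.1.sub hAi.1) hLi).symm
  have hBb (t : ℝ) (ht : 0 < t) : ‖(B + t • 1)⁻¹‖ ≤ 2 * K * (c + t)⁻¹ := by
    have h := hb t ht.le
    have hct : (c + t)⁻¹ ≤ c⁻¹ := by gcongr; linarith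
    have h1 : ‖(B + t • 1)⁻¹‖ ≤ K * (c + t)⁻¹ + 1 / 2 * ‖(B + t • 1)⁻¹‖ := by
      calc ‖(B + t • 1)⁻¹‖
          = ‖(A + t • 1)⁻¹ - (A + t • 1)⁻¹ * (B - A) * (B + t • 1)⁻¹‖ := by
            rw [← hA.resolvent_sub_resolvent hB ht.le, sub_sub_cancel]
        _ ≤ ‖(A + t • 1)⁻¹‖ + ‖(A + t • 1)⁻¹‖ * ‖B - A‖ * ‖(B + t • 1)⁻¹‖ :=
            (norm_sub_le _ _).trans (add_le_add_right ((frobenius_norm_mul _ _).trans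
              (mul_le_mul_of_nonneg_right (frobenius_norm_mul _ _) (norm_nonneg _))) _)
        _ ≤ K * (c + t)⁻¹ + (K * c⁻¹) * (c / (2 * K)) * ‖(B + t • 1)⁻¹‖ := by
            gcongr
            exact h.trans (by gcongr)
        _ = _ := by field_simp
    linarith
  rw [hrep]
  refine (norm_integral_le_of_norm_le ((integrableOn_inv_add_sq hc).const_mul
    (2 * K ^ 3 * c⁻¹ * ‖B - A‖ ^ 2)) ((ae_restrict_iff' measurableSet_Ioi).2
      (Filter.Eventually.of_forall fun t ht ↦ ?_))).trans_eq ?_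
  · have ht : 0 < t := ht
    have h := hb t ht.le
    have hct : (c + t)⁻¹ ≤ c⁻¹ := by gcongr; linarith
    have hid : ((1 + t)⁻¹ • 1 - (B + t • 1)⁻¹) - ((1 + t)⁻¹ • 1 - (A + t • 1)⁻¹) -
        (A + t • 1)⁻¹ * (B - A) * (A + t • 1)⁻¹ =
        -((A + t • 1)⁻¹ * (B - A) * ((A + t • 1)⁻¹ * (B - A) * (B + t • 1)⁻¹)) := by
      rw [← hA.resolvent_sub_resolvent hB ht.le, mul_sub (_ * (B - A)), ← hA.resolvent_sub_resolvent hB ht.le]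
      abel
    rw [hid, norm_neg]
    calc _ ≤ (‖(A + t • 1)⁻¹‖ * ‖B - A‖) * (‖(A + t • 1)⁻¹‖ * ‖B - A‖ * ‖(B + t • 1)⁻¹‖) := by
          refine (frobenius_norm_mul _ _).trans (mul_le_mul (frobenius_norm_mul _ _)
            ((frobenius_norm_mul _ _).trans (mul_le_mul_of_nonneg_right (frobenius_norm_mul _ _)
              (norm_nonneg _))) (norm_nonneg _) (by positivity))
      _ ≤ ((K * c⁻¹) * ‖B - A‖) * ((K * (c + t)⁻¹) * ‖B - A‖ * (2 * K * (c + t)⁻¹)) := by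
          gcongr
          · exact h.trans (by gcongr)
          · exact hBb t ht
      _ = _ := by ring
  · rw [integral_const_mul]
    ring

theorem Matrix.PosDef.hasFDerivWithinAt_matLog_matLogDeriv {n : ℕ}
    {A : Matrix (Fin n) (Fin n) ℂ} (hA : A.PosDef) :
    HasFDerivWithinAt matLog hA.matLogDeriv {B : Matrix (Fin n) (Fin n) ℂ | B.PosDef} A := by
  refine .of_isLittleO ?_
  obtain ⟨C, δ, hδ, h⟩ := hA.exists_norm_matLog_sub_sub_le
  refine Asymptotics.IsBigO.trans_isLittleO (g := fun B ↦ ‖B - A‖ ^ 2) ?_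
    ((Asymptotics.isLittleO_pow_sub_sub A one_lt_two).mono nhdsWithin_le_nhds)
  refine Asymptotics.IsBigO.of_bound C ?_
  filter_upwards [self_mem_nhdsWithin,
    nhdsWithin_le_nhds (Metric.closedBall_mem_nhds A hδ)] with B hB hBA
  rw [mem_closedBall_iff_norm] at hBA
  rw [Real.norm_of_nonneg (by positivity)]
  exact h B hB hBA

end FrobeniusTopology

/-- the Fréchet derivative of the matrix logarithm at a positive definite matrix
`A`, applied to `H`, is `∫₀^∞ (A + t·1)⁻¹ H (A + t·1)⁻¹ dt`. -/
theorem hasFDerivWithinAt_matLog {n : ℕ} (A : Matrix (Fin n) (Fin n) ℂ) (hA : A.PosDef) :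
    ∃ L : Matrix (Fin n) (Fin n) ℂ →L[ℝ] Matrix (Fin n) (Fin n) ℂ,
      HasFDerivWithinAt matLog L {B : Matrix (Fin n) (Fin n) ℂ | B.PosDef} A ∧
      ∀ H : Matrix (Fin n) (Fin n) ℂ,
        L H = ∫ t in Set.Ioi (0 : ℝ), (A + t • 1)⁻¹ * H * (A + t • 1)⁻¹ := by
  exact ⟨hA.matLogDeriv, hA.hasFDerivWithinAt_matLog_matLogDeriv, fun H ↦ rfl⟩
end

section
/- Let X be an invertible n×n complex matrix with ‖X‖ ≤ 1 (an invertible contraction), let A be a positive definite n×n complex matrix, and let B be an arbitrary n×n complex matrix. Then Q(X A X*, B) ≤ Q(A, X^{-1} B (X*)^{-1}), where Q(x,h) = ∫₀^∞ Tr( h* (x + t·1)^{-1} h (x + t·1)^{-1} ) dt. -/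
open Matrix MeasureTheory
open scoped ComplexOrder

attribute [local instance] Matrix.frobeniusNormedAddCommGroup Matrix.frobeniusNormedSpace

/-- The quadratic form `Q(x,h) = ∫₀^∞ Tr( h* (x+t·1)⁻¹ h (x+t·1)⁻¹ ) dt` (its value is real
for positive definite `x`, so we take the real part of the trace in the integrand). -/
noncomputable def Qform {n : ℕ} (x h : Matrix (Fin n) (Fin n) ℂ) : ℝ :=
  ∫ t in Set.Ioi (0 : ℝ), (Matrix.trace (hᴴ * (x + t • 1)⁻¹ * h * (x + t • 1)⁻¹)).re

namespace Matrix

variable {m : Type*} [Fintype m] [DecidableEq m]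

/-- Inversion is antitone on positive definite matrices for the Loewner order. -/
lemma PosDef.posSemidef_inv_sub_inv {P Q : Matrix m m ℂ} (hP : P.PosDef) (hQ : Q.PosDef)
    (h : (Q - P).PosSemidef) : (P⁻¹ - Q⁻¹).PosSemidef := by
  have hPd := P.isUnit_iff_isUnit_det.1 hP.isUnit
  have hQd := Q.isUnit_iff_isUnit_det.1 hQ.isUnit
  have hQi : Q⁻¹ᴴ = Q⁻¹ := hQ.inv.isHermitian
  have hDh : (Q - P)ᴴ = Q - P := h.isHermitian
  have h1 : Q⁻¹ * (Q - P) * P⁻¹ = P⁻¹ - Q⁻¹ := by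
    rw [mul_sub, sub_mul, nonsing_inv_mul _ hQd, one_mul, mul_assoc, mul_nonsing_inv _ hPd, mul_one]
  have h2 : P⁻¹ * (Q - P) * Q⁻¹ = P⁻¹ - Q⁻¹ := by
    rw [mul_sub, sub_mul, nonsing_inv_mul _ hPd, one_mul, mul_assoc, mul_nonsing_inv _ hQd, mul_one]
  have key : P⁻¹ - Q⁻¹ = Q⁻¹ * (Q - P) * Q⁻¹ᴴ
      + (Q⁻¹ * (Q - P)) * P⁻¹ * (Q⁻¹ * (Q - P))ᴴ := by
    rw [conjTranspose_mul, hQi, hDh]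
    calc P⁻¹ - Q⁻¹ = Q⁻¹ * (Q - P) * (Q⁻¹ + (P⁻¹ - Q⁻¹)) := by rw [add_sub_cancel, h1]
      _ = _ := by rw [← h2]; noncomm_ring
  rw [key]
  exact (h.mul_mul_conjTranspose_same _).add (hP.inv.posSemidef.mul_mul_conjTranspose_same _)

open scoped MatrixOrder in
lemma PosSemidef.trace_conjTranspose_mul_mul_mul_nonneg {P R : Matrix m m ℂ}
    (hP : P.PosSemidef) (hR : R.PosSemidef) (K : Matrix m m ℂ) :
    0 ≤ (Kᴴ * P * K * R).trace := by
  obtain ⟨S, rfl⟩ := CStarAlgebra.nonneg_iff_eq_star_mul_self.1 hR.nonneg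
  rw [star_eq_conjTranspose]
  have h := ((hP.conjTranspose_mul_mul_same K).mul_mul_conjTranspose_same S).trace_nonneg
  rwa [mul_assoc S, trace_mul_comm, mul_assoc] at h

lemma PosSemidef.trace_conjTranspose_mul_mul_mul_mono {P R : Matrix m m ℂ}
    (hP : P.PosSemidef) (hR : R.PosSemidef) (h : (R - P).PosSemidef) (K : Matrix m m ℂ) :
    (Kᴴ * P * K * P).trace ≤ (Kᴴ * R * K * R).trace := by
  have h1 := h.trace_conjTranspose_mul_mul_mul_nonneg hR K
  have h2 := hP.trace_conjTranspose_mul_mul_mul_nonneg h K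
  rw [mul_sub, sub_mul, sub_mul, trace_sub] at h1
  rw [mul_sub, trace_sub] at h2
  exact (sub_nonneg.1 h2).trans (sub_nonneg.1 h1)

lemma PosDef.exists_pos_posSemidef_sub_smul_one {A : Matrix m m ℂ} (hA : A.PosDef) :
    ∃ c : ℝ, 0 < c ∧ (A - c • (1 : Matrix m m ℂ)).PosSemidef := by
  cases isEmpty_or_nonempty m
  · exact ⟨1, one_pos, by rw [Subsingleton.elim (A - _) 0]; exact .zero⟩
  obtain ⟨i, hi⟩ := Finite.exists_min hA.isHermitian.eigenvalues
  refine ⟨hA.isHermitian.eigenvalues i, hA.eigenvalues_pos i, ?_⟩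
  set U := (hA.isHermitian.eigenvectorUnitary : Matrix m m ℂ) with hU
  have hUU : U * Uᴴ = 1 := Unitary.coe_mul_star_self hA.isHermitian.eigenvectorUnitary
  have hAU : A = U * diagonal (RCLike.ofReal ∘ hA.isHermitian.eigenvalues) * Uᴴ := by
    conv_lhs => rw [hA.isHermitian.spectral_theorem, Unitary.conjStarAlgAut_apply]
    rfl
  have hdiag : (diagonal (RCLike.ofReal ∘ hA.isHermitian.eigenvalues)
      - hA.isHermitian.eigenvalues i • (1 : Matrix m m ℂ)).PosSemidef := by
    rw [← diagonal_one, ← diagonal_smul, diagonal_sub, posSemidef_diagonal_iff]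
    intro j
    simpa using hi j
  have h := hdiag.mul_mul_conjTranspose_same U
  rwa [mul_sub, sub_mul, ← hAU, mul_smul_comm, smul_mul_assoc, mul_one, hUU] at h

lemma PosDef.add_smul_one {k : Type*} [DecidableEq k] {A : Matrix k k ℂ} (hA : A.PosDef)
    {t : ℝ} (ht : 0 ≤ t) : (A + t • (1 : Matrix k k ℂ)).PosDef :=
  hA.add_posSemidef (PosSemidef.one.smul ht)

end Matrix

lemma integrableOn_Qform_integrand {n : ℕ} {A : Matrix (Fin n) (Fin n) ℂ} (hA : A.PosDef)
    (K : Matrix (Fin n) (Fin n) ℂ) :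
    IntegrableOn (fun t : ℝ => (Matrix.trace (Kᴴ * (A + t • 1)⁻¹ * K * (A + t • 1)⁻¹)).re)
      (Set.Ioi 0) := by
  obtain ⟨c, hc, hAc⟩ := hA.exists_pos_posSemidef_sub_smul_one
  have hbound : IntegrableOn (fun t : ℝ => (Matrix.trace (Kᴴ * K)).re * (t + c) ^ (-2 : ℝ))
      (Set.Ioi 0) :=
    (integrableOn_add_rpow_Ioi_of_lt (by norm_num) (by linarith)).const_mul _
  refine Integrable.mono' hbound ?_ ?_
  · refine ContinuousOn.aestronglyMeasurable ?_ measurableSet_Ioi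
    have hlin : Continuous fun t : ℝ => A + t • (1 : Matrix (Fin n) (Fin n) ℂ) := by fun_prop
    have hinv : ContinuousOn (fun t : ℝ => (A + t • (1 : Matrix (Fin n) (Fin n) ℂ))⁻¹)
        (Set.Ioi 0) := by
      simp only [inv_def, Ring.inverse_eq_inv']
      refine ContinuousOn.smul (hlin.matrix_det.continuousOn.inv₀ fun t ht => ?_)
        hlin.matrix_adjugate.continuousOn
      exact (hA.add_smul_one (le_of_lt ht)).det_pos.ne'
    refine Complex.continuous_re.comp_continuousOn
      ((continuous_id.matrix_trace).comp_continuousOn ?_)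
    exact ((continuousOn_const.mul hinv).mul continuousOn_const).mul hinv
  · refine (ae_restrict_mem measurableSet_Ioi).mono fun t ht => ?_
    have ht : 0 < t := ht
    have hP := hA.add_smul_one ht.le
    have htc : 0 < t + c := by positivity
    have hQ : ((t + c) • (1 : Matrix (Fin n) (Fin n) ℂ)).PosDef := PosDef.one.smul htc
    have hQi : ((t + c) • (1 : Matrix (Fin n) (Fin n) ℂ))⁻¹ = (t + c)⁻¹ • 1 := by
      refine inv_eq_right_inv ?_
      rw [smul_mul_smul_comm, mul_inv_cancel₀ htc.ne', one_smul, mul_one]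
    have hle := hQ.posSemidef_inv_sub_inv hP (by
      rwa [add_smul, add_comm (t • _), add_sub_add_right_eq_sub])
    have hmono := (Complex.le_def.1 <|
      hP.inv.posSemidef.trace_conjTranspose_mul_mul_mul_mono hQ.inv.posSemidef hle K).1
    have hnn := (Complex.le_def.1 <| hP.inv.posSemidef.trace_conjTranspose_mul_mul_mul_nonneg
      hP.inv.posSemidef K).1
    rw [Real.norm_of_nonneg hnn]
    refine hmono.trans_eq ?_
    rw [hQi, Real.rpow_neg htc.le]
    simp only [mul_smul_comm, smul_mul_assoc, mul_one, trace_smul, Complex.real_smul,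
      Complex.re_ofReal_mul, Real.rpow_ofNat]
    field_simp

/-- The integrand of `Qform` under congruence by an invertible matrix. -/
lemma trace_conj_resolvent {n : ℕ} {X : Matrix (Fin n) (Fin n) ℂ} (hX : IsUnit X)
    (A B : Matrix (Fin n) (Fin n) ℂ) (t : ℝ) :
    (Bᴴ * (X * A * Xᴴ + t • 1)⁻¹ * B * (X * A * Xᴴ + t • 1)⁻¹).trace =
      ((X⁻¹ * B * (Xᴴ)⁻¹)ᴴ * (A + t • (X⁻¹ * (Xᴴ)⁻¹))⁻¹ * (X⁻¹ * B * (Xᴴ)⁻¹)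
        * (A + t • (X⁻¹ * (Xᴴ)⁻¹))⁻¹).trace := by
  have hXd := X.isUnit_iff_isUnit_det.1 hX
  have hXd' : IsUnit Xᴴ.det := Xᴴ.isUnit_iff_isUnit_det.1 hX.star
  have hx : X * A * Xᴴ + t • 1 = X * (A + t • (X⁻¹ * (Xᴴ)⁻¹)) * Xᴴ := by
    rw [mul_add, add_mul, mul_smul_comm, smul_mul_assoc, ← mul_assoc X, mul_nonsing_inv _ hXd,
      one_mul, nonsing_inv_mul _ hXd']
  rw [hx, Matrix.mul_inv_rev, Matrix.mul_inv_rev]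
  simp only [conjTranspose_mul, conjTranspose_nonsing_inv, conjTranspose_conjTranspose, mul_assoc]
  rw [← mul_assoc, ← mul_assoc, ← mul_assoc, ← mul_assoc, ← mul_assoc, ← mul_assoc, ← mul_assoc,
    trace_mul_comm]
  simp only [mul_assoc]

/-- for an invertible contraction `X` (i.e. `X*X ≤ 1`), a positive definite `A`
and arbitrary `B`, one has `Q(X A X*, B) ≤ Q(A, X⁻¹ B (X*)⁻¹)`. -/
theorem Qform_conj_contraction_le {n : ℕ} (X : Matrix (Fin n) (Fin n) ℂ)
    (hX : IsUnit X) (hX1 : ((1 : Matrix (Fin n) (Fin n) ℂ) - Xᴴ * X).PosSemidef)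
    (A : Matrix (Fin n) (Fin n) ℂ) (hA : A.PosDef) (B : Matrix (Fin n) (Fin n) ℂ) :
    Qform (X * A * Xᴴ) B ≤ Qform A (X⁻¹ * B * (Xᴴ)⁻¹) := by
  have hG : (X⁻¹ * (Xᴴ)⁻¹ - 1).PosSemidef := by
    have hXX := PosDef.conjTranspose_mul_self X (mulVec_injective_of_isUnit hX)
    have h := hXX.posSemidef_inv_sub_inv PosDef.one hX1
    rwa [Matrix.mul_inv_rev, inv_one] at h
  have hGpos : (X⁻¹ * (Xᴴ)⁻¹).PosSemidef := by
    rw [← conjTranspose_nonsing_inv]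
    exact posSemidef_self_mul_conjTranspose _
  have hAG {t : ℝ} (ht : 0 ≤ t) : (A + t • (X⁻¹ * (Xᴴ)⁻¹)).PosDef :=
    hA.add_posSemidef (hGpos.smul ht)
  refine integral_mono_of_nonneg ?_ (integrableOn_Qform_integrand hA _) ?_ <;>
    refine (ae_restrict_mem measurableSet_Ioi).mono fun t (ht : 0 < t) => ?_
  · have hp := (hAG ht.le).inv.posSemidef
    simp only [trace_conj_resolvent hX]
    exact (Complex.le_def.1 <| hp.trace_conjTranspose_mul_mul_mul_nonneg hp _).1
  · simp only [trace_conj_resolvent hX]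
    have hA' := hA.add_smul_one ht.le
    refine (Complex.le_def.1 <| (hAG ht.le).inv.posSemidef.trace_conjTranspose_mul_mul_mul_mono
      hA'.inv.posSemidef (hA'.posSemidef_inv_sub_inv (hAG ht.le) ?_) _).1
    rw [add_sub_add_left_eq_sub, ← smul_sub]
    exact hG.smul ht.le
end
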